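/- Let X ⊆ ℝ/ℤ be an open set that is a finite disjoint union of intervals X = ⋃_{i=1}^q (a_i, b_i), and let Λ ⊆ X be a finite set with |X point-to-set distance| property: every x ∈ X is within distance τ/K of Λ. Define J as the set of indices j with gap a_j - b_{j-1} < τ/K (cyclically), and Y = (⋃ [a_i, b_i]) ∪ (⋃_{j∈J} [b_{j-1}, a_j]). If η > 3τ/K, then: (1) Y is a disjoint union of at most |Λ| intervals; (2) each interval of Y contains at least one point of Λ; (3) Λ ⊆ Y ⊆ B(Λ, η) on the torus, and the total length of Y is at most |Λ|·η. -/

import Mathlib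

open scoped BigOperators

/-- The projection from `ℝ` to the torus `ℝ/ℤ`. -/
noncomputable def torus (x : ℝ) : AddCircle (1 : ℝ) := (x : AddCircle (1 : ℝ))

theorem torus_add_int (x : ℝ) (z : ℤ) : torus (x + z) = torus x := by
  unfold torus
  rw [AddCircle.coe_add, add_eq_left, AddCircle.coe_eq_zero_iff]
  exact ⟨z, by simp⟩

theorem torus_dist (x y : ℝ) : dist (torus x) (torus y) = |x - y - round (x - y)| := by
  unfold torus
  rw [dist_eq_norm, ← AddCircle.coe_sub, UnitAddCircle.norm_eq]

theorem torus_dist_le (x y : ℝ) : dist (torus x) (torus y) ≤ |x - y| := by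
  rw [torus_dist]
  simpa using round_le (x - y) 0

theorem torus_dist_lt {x y δ : ℝ} (h1 : δ < y - x) (h2 : y - x < 1 - δ) :
    δ < dist (torus x) (torus y) := by
  rw [dist_comm, torus_dist]
  generalize round (y - x) = z
  rw [lt_abs]
  rcases le_or_gt z 0 with h | h
  · left
    have : (z : ℝ) ≤ 0 := by exact_mod_cast h
    linarith
  · right
    have : (1 : ℝ) ≤ z := by exact_mod_cast h
    linarith

theorem torus_ne {x y : ℝ} (h1 : 0 < y - x) (h2 : y - x < 1) : torus x ≠ torus y := by
  have := torus_dist_lt (δ := 0) h1 (by linarith)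
  exact dist_pos.1 this

theorem torus_continuous : Continuous torus := AddCircle.continuous_mk' 1

theorem torus_exists (u : ℝ) (y : AddCircle (1 : ℝ)) :
    ∃ x, u ≤ x ∧ x < u + 1 ∧ torus x = y := by
  obtain ⟨t, rfl⟩ := QuotientAddGroup.mk_surjective y
  refine ⟨t + ((-⌊t - u⌋ : ℤ) : ℝ), ?_, ?_, torus_add_int _ _⟩
  · have := Int.floor_le (t - u)
    push_cast; linarith
  · have := Int.lt_floor_add_one (t - u)
    push_cast; linarith

theorem torus_volume {c d : ℝ} (h1 : d ≤ c + 1) :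
    ENNReal.ofReal (d - c) ≤ MeasureTheory.volume (torus '' Set.Icc c d) := by
  have hsub : Metric.closedBall (torus ((c + d) / 2)) ((d - c) / 2) ⊆ torus '' Set.Icc c d := by
    intro y hy
    obtain ⟨x, hx1, hx2, rfl⟩ := torus_exists ((c + d) / 2 - 1 / 2) y
    rw [Metric.mem_closedBall, torus_dist] at hy
    set t := x - (c + d) / 2 with ht
    have key : |t| ≤ (d - c) / 2 ∨ (t = -(1/2)) := by
      by_cases h : t = -(1/2)
      · exact Or.inr h
      · left
        have h3 : -(1/2) < t := lt_of_le_of_ne (by linarith) (Ne.symm h)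
        have : round t = 0 := by
          rw [round_eq_zero_iff]
          exact ⟨by linarith, by linarith⟩
        rw [this] at hy
        simpa using hy
    rcases key with h | h
    · rw [abs_le] at h
      exact ⟨x, ⟨by linarith, by linarith⟩, rfl⟩
    · have : round t = 0 ∨ True := Or.inr trivial
      have h5 : (1:ℝ)/2 ≤ |t - round t| := by
        generalize round t = z
        rw [h, le_abs]
        rcases le_or_gt 0 z with h | h
        · right
          have : (0 : ℝ) ≤ z := by exact_mod_cast h
          linarith
        · left
          have : z ≤ -1 := by omega
          have : (z : ℝ) ≤ -1 := by exact_mod_cast this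
          linarith
      exact ⟨x, ⟨by linarith, by linarith⟩, rfl⟩
  refine le_trans (le_of_eq ?_) (MeasureTheory.measure_mono hsub)
  rw [AddCircle.volume_closedBall, min_eq_right (by linarith)]
  congr 1
  ring

theorem finish {ι : Type} [Fintype ι] (δ η : ℝ) (hδ : 0 < δ) (hη : 3 * δ < η)
    (Λ : Finset (AddCircle (1 : ℝ))) (Y : Set (AddCircle (1 : ℝ)))
    (c d : ι → ℝ) (hcd : ∀ i, c i < d i) (hcd1 : ∀ i, d i ≤ c i + 1)
    (hdisj : ∀ i j, i ≠ j → Disjoint (torus '' Set.Icc (c i) (d i)) (torus '' Set.Icc (c j) (d j)))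
    (hYeq : Y = ⋃ i, torus '' Set.Icc (c i) (d i))
    (hpt : ∀ i, ∃ l ∈ Λ, l ∈ torus '' Set.Icc (c i) (d i))
    (hΛ : (↑Λ : Set (AddCircle (1 : ℝ))) ⊆ Y)
    (hnear : ∀ y ∈ Y, ∃ l ∈ Λ, dist y l ≤ 3 * δ / 2) :
    ∃ m : ℕ, m ≤ Λ.card ∧ ∃ cc dd : Fin m → ℝ,
      (∀ i, cc i < dd i) ∧
      (∀ i j, i ≠ j →
        Disjoint (torus '' Set.Icc (cc i) (dd i)) (torus '' Set.Icc (cc j) (dd j))) ∧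
      (Y = ⋃ i, torus '' Set.Icc (cc i) (dd i)) ∧
      (∀ i, ∃ l ∈ Λ, l ∈ torus '' Set.Icc (cc i) (dd i)) ∧
      ((↑Λ : Set (AddCircle (1 : ℝ))) ⊆ ⋃ i, torus '' Set.Icc (cc i) (dd i)) ∧
      (∀ y ∈ ⋃ i, torus '' Set.Icc (cc i) (dd i), ∃ l ∈ Λ, dist y l ≤ η) ∧
      ∑ i, (dd i - cc i) ≤ (Λ.card : ℝ) * η := by
  let e := (Fintype.equivFin ι).symm
  have hU : Y = ⋃ i, torus '' Set.Icc (c (e i)) (d (e i)) := by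
    rw [hYeq]
    exact (e.surjective.iUnion_comp (fun i => torus '' Set.Icc (c i) (d i))).symm
  refine ⟨Fintype.card ι, ?_, fun i => c (e i), fun i => d (e i), fun i => hcd _,
    fun i j hij => hdisj _ _ (fun h => hij (e.injective h)), hU, fun i => hpt _, hU ▸ hΛ, ?_, ?_⟩
  · choose f hf1 hf2 using hpt
    have := Finset.card_le_card_of_injOn (s := Finset.univ) (t := Λ) f (fun i _ => hf1 i) (by
      intro i _ j _ hij
      by_contra hne
      exact Set.disjoint_left.1 (hdisj i j hne) (hf2 i) (hij ▸ hf2 j))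
    simpa using this
  · rw [← hU]
    intro y hy
    obtain ⟨l, hl, h⟩ := hnear y hy
    exact ⟨l, hl, by linarith⟩
  · have hsum : ∑ i, (d (e i) - c (e i)) = ∑ i, (d i - c i) :=
      e.sum_comp (fun i => d i - c i)
    rw [hsum]
    have hvol : MeasureTheory.volume Y = ∑ i, MeasureTheory.volume (torus '' Set.Icc (c i) (d i)) := by
      rw [hYeq, MeasureTheory.measure_iUnion, tsum_fintype]
      · intro i j hij; exact hdisj i j hij
      · intro i
        exact (isCompact_Icc.image torus_continuous).measurableSet
    have h1 : ENNReal.ofReal (∑ i, (d i - c i)) ≤ MeasureTheory.volume Y := by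
      rw [hvol, ENNReal.ofReal_sum_of_nonneg (fun i _ => by linarith [hcd i])]
      exact Finset.sum_le_sum fun i _ => torus_volume (hcd1 i)
    have h2 : MeasureTheory.volume Y ≤ ENNReal.ofReal (Λ.card * (3 * δ)) := by
      calc MeasureTheory.volume Y
          ≤ MeasureTheory.volume (⋃ l ∈ Λ, Metric.closedBall l (3 * δ / 2)) := by
            apply MeasureTheory.measure_mono
            intro y hy
            obtain ⟨l, hl, h⟩ := hnear y hy
            simp only [Set.mem_iUnion]
            exact ⟨l, hl, h⟩
        _ ≤ ∑ l ∈ Λ, MeasureTheory.volume (Metric.closedBall l (3 * δ / 2)) :=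
            MeasureTheory.measure_biUnion_finset_le _ _
        _ ≤ ∑ l ∈ Λ, ENNReal.ofReal (3 * δ) := by
            apply Finset.sum_le_sum
            intro l _
            rw [AddCircle.volume_closedBall]
            apply ENNReal.ofReal_le_ofReal
            exact (min_le_right _ _).trans (by linarith)
        _ = _ := by
            rw [← ENNReal.ofReal_sum_of_nonneg (fun i _ => by linarith)]
            simp
    have h3 := (ENNReal.ofReal_le_ofReal_iff (by positivity)).1 (h1.trans h2)
    have h4 : (0:ℝ) ≤ Λ.card := by positivity
    nlinarith

theorem core (δ η : ℝ) (hδ : 0 < δ) (hη : 3 * δ < η) (N : ℤ) (hN : 0 < N)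
    (A B : ℤ → ℝ) (hAB : ∀ i, A i < B i) (hBA : ∀ i, B (i - 1) ≤ A i)
    (hA : ∀ i z : ℤ, A (i + N * z) = A i + z) (hB : ∀ i z : ℤ, B (i + N * z) = B i + z)
    (Λ : Finset (AddCircle (1 : ℝ))) (Y : Set (AddCircle (1 : ℝ)))
    (hArc : ∀ i, ∀ x ∈ Set.Icc (A i) (B i), torus x ∈ Y)
    (hGap : ∀ i, A i - B (i - 1) < δ → ∀ x ∈ Set.Icc (B (i - 1)) (A i), torus x ∈ Y)
    (hY : ∀ y ∈ Y, ∃ i, ∃ x, torus x = y ∧ (x ∈ Set.Icc (A i) (B i) ∨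
      (A i - B (i - 1) < δ ∧ x ∈ Set.Icc (B (i - 1)) (A i))))
    (hΛX : ∀ l ∈ Λ, ∃ i, ∃ x ∈ Set.Ioo (A i) (B i), torus x = l)
    (hcover : ∀ i, ∀ x ∈ Set.Ioo (A i) (B i), ∃ l ∈ Λ, dist (torus x) l ≤ δ) :
    ∃ m : ℕ, m ≤ Λ.card ∧ ∃ cc dd : Fin m → ℝ,
      (∀ i, cc i < dd i) ∧
      (∀ i j, i ≠ j →
        Disjoint (torus '' Set.Icc (cc i) (dd i)) (torus '' Set.Icc (cc j) (dd j))) ∧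
      (Y = ⋃ i, torus '' Set.Icc (cc i) (dd i)) ∧
      (∀ i, ∃ l ∈ Λ, l ∈ torus '' Set.Icc (cc i) (dd i)) ∧
      ((↑Λ : Set (AddCircle (1 : ℝ))) ⊆ ⋃ i, torus '' Set.Icc (cc i) (dd i)) ∧
      (∀ y ∈ ⋃ i, torus '' Set.Icc (cc i) (dd i), ∃ l ∈ Λ, dist y l ≤ η) ∧
      ∑ i, (dd i - cc i) ≤ (Λ.card : ℝ) * η := by
  have hBA' : ∀ i, B i ≤ A (i + 1) := fun i => by simpa using hBA (i + 1)
  have hAm : Monotone A := monotone_int_of_le_succ fun i => (hAB i).le.trans (hBA' i)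
  have hBm : Monotone B := monotone_int_of_le_succ fun i => (hBA' i).trans (hAB _).le
  have hΛY : (↑Λ : Set (AddCircle (1 : ℝ))) ⊆ Y := by
    intro l hl
    obtain ⟨i, x, hx, rfl⟩ := hΛX l hl
    exact hArc i x ⟨hx.1.le, hx.2.le⟩
  have hclose : ∀ i, ∀ x ∈ Set.Icc (A i) (B i), ∃ l ∈ Λ, dist (torus x) l ≤ δ := by
    intro i x hx
    have hcl : IsClosed {x : ℝ | ∃ l ∈ Λ, dist (torus x) l ≤ δ} := by
      have : {x : ℝ | ∃ l ∈ Λ, dist (torus x) l ≤ δ} =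
          ⋃ l ∈ Λ, {x : ℝ | dist (torus x) l ≤ δ} := by ext; simp
      rw [this]
      exact Λ.finite_toSet.isClosed_biUnion fun l _ =>
        isClosed_le (torus_continuous.dist continuous_const) continuous_const
    have h := closure_minimal (s := Set.Ioo (A i) (B i)) (fun x hx => hcover i x hx) hcl
    rw [closure_Ioo (hAB i).ne] at h
    exact h hx
  have hnear : ∀ y ∈ Y, ∃ l ∈ Λ, dist y l ≤ 3 * δ / 2 := by
    intro y hy
    obtain ⟨i, x, rfl, hx | ⟨hg, hx⟩⟩ := hY y hy
    · obtain ⟨l, hl, h⟩ := hclose i x hx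
      exact ⟨l, hl, by linarith⟩
    · have : ∃ j, ∃ z ∈ Set.Icc (A j) (B j), |x - z| ≤ δ / 2 := by
        rcases le_total x ((B (i - 1) + A i) / 2) with h | h
        · refine ⟨i - 1, B (i - 1), ⟨(hAB _).le, le_rfl⟩, ?_⟩
          rw [abs_le]; constructor <;> linarith [hx.1]
        · refine ⟨i, A i, ⟨le_rfl, (hAB _).le⟩, ?_⟩
          rw [abs_le]; constructor <;> linarith [hx.2]
      obtain ⟨j, z, hz, hxz⟩ := this
      obtain ⟨l, hl, h⟩ := hclose j z hz
      refine ⟨l, hl, ?_⟩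
      linarith [dist_triangle (torus x) (torus z) l, torus_dist_le x z]
  have hchain : ∀ k j, k ≤ j → (∀ i, k < i → i ≤ j → A i - B (i - 1) < δ) →
      ∀ x ∈ Set.Icc (A k) (B j), torus x ∈ Y := by
    intro k j hkj
    induction j, hkj using Int.leInduction with
    | base => intro _ x hx; exact hArc k x hx
    | succ j hkj ih =>
      intro hs x hx
      have h1 := hs (j + 1) (by omega) le_rfl
      rcases le_total x (B j) with h | h
      · exact ih (fun i h1 h2 => hs i h1 (by omega)) x ⟨hx.1, h⟩
      · rcases le_total x (A (j + 1)) with h' | h'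
        · exact hGap (j + 1) h1 x ⟨by simpa using h, h'⟩
        · exact hArc (j + 1) x ⟨h', hx.2⟩
  by_cases hP : ∃ k, δ ≤ A k - B (k - 1)
  swap
  · push Not at hP
    have hYall : ∀ y, y ∈ Y := by
      intro y
      obtain ⟨x, h1, h2, rfl⟩ := torus_exists (A 0) y
      have hN' := hA 0 1
      have := hAB (0 + N * 1)
      push_cast at hN'
      exact hchain 0 (0 + N * 1) (by omega) (fun i _ _ => hP i) x ⟨h1, by linarith⟩
    have hall : ∀ y, y ∈ torus '' Set.Icc (A 0) (A 0 + 1) := by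
      intro y
      obtain ⟨x, h1, h2, rfl⟩ := torus_exists (A 0) y
      exact ⟨x, ⟨h1, h2.le⟩, rfl⟩
    obtain ⟨l, hl, -⟩ := hclose 0 (A 0) ⟨le_rfl, (hAB 0).le⟩
    refine finish (ι := Unit) δ η hδ hη Λ Y (fun _ => A 0) (fun _ => A 0 + 1) (by simp) (by simp)
      (fun i j h => (h rfl).elim) ?_ (fun _ => ⟨l, hl, hall l⟩) hΛY hnear
    ext y
    simp only [hYall, Set.mem_iUnion, true_iff]
    exact ⟨(), hall y⟩
  · have hper : ∀ k z : ℤ, δ ≤ A k - B (k - 1) → δ ≤ A (k + N * z) - B (k + N * z - 1) := by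
      intro k z h
      have : k + N * z - 1 = (k - 1) + N * z := by ring
      rw [this, hA, hB]; linarith
    have hnext : ∀ k, δ ≤ A k - B (k - 1) → ∃ k', (k < k' ∧ δ ≤ A k' - B (k' - 1)) ∧
        ∀ z, (k < z ∧ δ ≤ A z - B (z - 1)) → k' ≤ z := by
      intro k hk
      exact Int.exists_least_of_bdd ⟨k, fun z hz => hz.1.le⟩
        ⟨k + N * 1, by omega, hper k 1 hk⟩
    choose! nx hnx1 hnx2 using hnext
    let ι := {k : ℤ // k ∈ (Finset.Ico 0 N).filter (fun k => δ ≤ A k - B (k - 1))}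
    haveI : Fintype ι := Finset.Subtype.fintype _
    have hι : ∀ k : ι, 0 ≤ k.1 ∧ k.1 < N ∧ δ ≤ A k.1 - B (k.1 - 1) := by
      intro k
      have := k.2
      simp only [Finset.mem_filter, Finset.mem_Ico] at this
      tauto
    have hnxN : ∀ k : ι, B (nx k.1 - 1) ≤ A k.1 + 1 - δ := by
      intro k
      obtain ⟨h1, h2, h3⟩ := hι k
      have h4 := hnx2 k.1 h3 (k.1 + N * 1) ⟨by omega, hper _ 1 h3⟩
      have h5 := hper _ 1 h3
      rw [hA] at h5
      have h6 : B (nx k.1 - 1) ≤ B (k.1 + N * 1 - 1) := hBm (by omega)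
      push_cast at h5
      linarith
    have hAnx : ∀ k : ι, B k.1 ≤ B (nx k.1 - 1) := by
      intro k
      have := (hnx1 k.1 (hι k).2.2).1
      exact hBm (by omega)
    have hsep : ∀ k k' : ι, k.1 < k'.1 →
        B (nx k.1 - 1) ≤ A k'.1 - δ ∧ B (nx k'.1 - 1) ≤ A k.1 + 1 - δ := by
      intro k k' hlt
      obtain ⟨h1, h2, h3⟩ := hι k
      obtain ⟨h1', h2', h3'⟩ := hι k'
      constructor
      · have := hnx2 k.1 h3 k'.1 ⟨hlt, h3'⟩
        have : B (nx k.1 - 1) ≤ B (k'.1 - 1) := hBm (by omega)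
        linarith
      · have := hnx2 k'.1 h3' (k.1 + N * 1) ⟨by omega, hper _ 1 h3⟩
        have h5 := hper _ 1 h3
        rw [hA] at h5
        have : B (nx k'.1 - 1) ≤ B (k.1 + N * 1 - 1) := hBm (by omega)
        push_cast at h5
        linarith
    have hYeq : Y = ⋃ k : ι, torus '' Set.Icc (A k.1) (B (nx k.1 - 1)) := by
      apply Set.Subset.antisymm
      · intro y hy
        have hred : ∃ i x, torus x = y ∧ x ≤ B i ∧ (A i ≤ x ∨ (A i - B (i - 1) < δ ∧ B (i - 1) ≤ x)) := by
          obtain ⟨i, x, hxy, hx | ⟨hg, hx⟩⟩ := hY y hy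
          · exact ⟨i, x, hxy, hx.2, Or.inl hx.1⟩
          · exact ⟨i, x, hxy, hx.2.trans (hAB i).le, Or.inr ⟨hg, hx.1⟩⟩
        obtain ⟨i, x, hxy, hxB, hx⟩ := hred
        -- last break not exceeding i
        obtain ⟨k₀, hk₀⟩ := hP
        obtain ⟨k, ⟨hki, hk⟩, hkmax⟩ := Int.exists_greatest_of_bdd
          (P := fun k => k ≤ i ∧ δ ≤ A k - B (k - 1)) ⟨i, fun z hz => hz.1⟩
          ⟨k₀ + N * (-|k₀ - i|), by
            have := le_abs_self (k₀ - i)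
            have := abs_nonneg (k₀ - i)
            nlinarith, hper _ _ hk₀⟩
        have hAx : A k ≤ x := by
          rcases hx with h | ⟨hg, h⟩
          · exact (hAm hki).trans h
          · have hne : k ≠ i := by rintro rfl; linarith
            have : k ≤ i - 1 := by omega
            exact (hAm this).trans ((hAB _).le.trans h)
        have hdm := Int.emod_add_mul_ediv k N
        set z := k / N
        have hk0 : k % N = k + N * (-z) := by linarith
        have hkb : δ ≤ A (k % N) - B (k % N - 1) := by rw [hk0]; exact hper _ _ hk
        have hmem : k % N ∈ (Finset.Ico 0 N).filter (fun k => δ ≤ A k - B (k - 1)) := by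
          simp only [Finset.mem_filter, Finset.mem_Ico]
          exact ⟨⟨Int.emod_nonneg _ hN.ne', Int.emod_lt_of_pos _ hN⟩, hkb⟩
        refine Set.mem_iUnion.2 ⟨⟨k % N, hmem⟩, x + ((-z : ℤ) : ℝ), ⟨?_, ?_⟩, ?_⟩
        · simp only [hk0, hA]; linarith
        · have hlt : i + N * (-z) < nx (k % N) := by
            by_contra hcon
            obtain ⟨h1, h2⟩ := hnx1 _ hkb
            have h3 := hkmax (nx (k % N) + N * z) ⟨by linarith, hper _ _ h2⟩
            linarith
          have : B (i + N * (-z)) ≤ B (nx (k % N) - 1) := hBm (by omega)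
          rw [hB] at this
          simp only
          linarith
        · rw [torus_add_int, hxy]
      · intro y hy
        obtain ⟨k, x, hx, rfl⟩ := Set.mem_iUnion.1 hy
        obtain ⟨h1, h2, h3⟩ := hι k
        have h4 := (hnx1 _ h3).1
        refine hchain k.1 (nx k.1 - 1) (by omega) ?_ x hx
        intro i hi1 hi2
        by_contra hcon
        have := hnx2 _ h3 i ⟨hi1, not_lt.1 hcon⟩
        omega
    refine finish (ι := ι) δ η hδ hη Λ Y (fun k => A k.1) (fun k => B (nx k.1 - 1))
      (fun k => (hAB _).trans_le (hAnx k)) (fun k => by linarith [hnxN k]) ?_ hYeq ?_ hΛY hnear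
    · have hd : ∀ k k' : ι, k.1 < k'.1 → Disjoint (torus '' Set.Icc (A k.1) (B (nx k.1 - 1)))
          (torus '' Set.Icc (A k'.1) (B (nx k'.1 - 1))) := by
        intro k k' hlt
        obtain ⟨h1, h2⟩ := hsep k k' hlt
        rw [Set.disjoint_left]
        rintro _ ⟨x, hx, rfl⟩ ⟨x', hx', h⟩
        exact torus_ne (x := x) (y := x') (by linarith [hx.2, hx'.1]) (by linarith [hx.1, hx'.2]) h.symm
      intro k k' hne
      rcases lt_or_gt_of_ne (fun h => hne (Subtype.ext h) : k.1 ≠ k'.1) with h | h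
      · exact hd k k' h
      · exact (hd k' k h).symm
    · intro k
      have h0 := hAB k.1
      obtain ⟨l, hl, hdl⟩ := hcover k.1 ((A k.1 + B k.1) / 2) ⟨by linarith, by linarith⟩
      refine ⟨l, hl, ?_⟩
      have hlY := hΛY hl
      rw [hYeq] at hlY
      obtain ⟨k', x, hx, rfl⟩ := Set.mem_iUnion.1 hlY
      by_cases hkk : k = k'
      · subst hkk; exact ⟨x, hx, rfl⟩
      exfalso
      have hB' := hAnx k
      rcases lt_or_gt_of_ne (fun h => hkk (Subtype.ext h) : k.1 ≠ k'.1) with h | h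
      · obtain ⟨h1, h2⟩ := hsep k k' h
        have := torus_dist_lt (δ := δ) (x := (A k.1 + B k.1) / 2) (y := x)
          (by linarith [hx.1]) (by linarith [hx.2])
        linarith
      · obtain ⟨h1, h2⟩ := hsep k' k h
        have := torus_dist_lt (δ := δ) (x := x) (y := (A k.1 + B k.1) / 2)
          (by linarith [hx.2]) (by linarith [hx.1])
        rw [dist_comm] at this
        linarith


theorem ext_periodic (n : ℕ) (f : Fin (n + 1) → ℝ) : ∃ F : ℤ → ℝ,
    ∀ (j : Fin (n + 1)) (q : ℤ), F ((j : ℕ) + ((n : ℤ) + 1) * q) = f j + q := by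
  refine ⟨fun i => f (Fin.ofNat (n + 1) (i % ((n : ℤ) + 1)).toNat) + ((i / ((n : ℤ) + 1) : ℤ) : ℝ), ?_⟩
  intro j q
  have hj := j.2
  have h0 : (((j : ℕ) : ℤ) + ((n : ℤ) + 1) * q) % ((n : ℤ) + 1) = (j : ℕ) := by
    rw [Int.add_mul_emod_self_left]
    exact Int.emod_eq_of_lt (by omega) (by omega)
  have h1 : (((j : ℕ) : ℤ) + ((n : ℤ) + 1) * q) / ((n : ℤ) + 1) = q := by
    rw [Int.add_mul_ediv_left _ _ (by omega), Int.ediv_eq_zero_of_lt (by omega) (by omega), zero_add]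
  simp only [h0, h1, Int.toNat_natCast]
  congr 2
  ext
  simp [Fin.ofNat, Nat.mod_eq_of_lt hj]

theorem int_repr (n : ℕ) (i : ℤ) : ∃ (j : Fin (n + 1)) (q : ℤ), i = (j : ℕ) + ((n : ℤ) + 1) * q := by
  have h1 := Int.emod_nonneg i (b := (n : ℤ) + 1) (by omega)
  have h2 := Int.emod_lt_of_pos i (b := (n : ℤ) + 1) (by omega)
  refine ⟨⟨(i % ((n : ℤ) + 1)).toNat, by omega⟩, i / ((n : ℤ) + 1), ?_⟩
  have := Int.emod_add_mul_ediv i ((n : ℤ) + 1)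
  simp only [Int.toNat_of_nonneg h1]
  linarith

theorem ext_prev (n : ℕ) (f : Fin (n + 1) → ℝ) (F : ℤ → ℝ)
    (hF : ∀ (j : Fin (n + 1)) (q : ℤ), F ((j : ℕ) + ((n : ℤ) + 1) * q) = f j + q)
    (j : Fin (n + 1)) (q : ℤ) :
    F ((j : ℕ) + ((n : ℤ) + 1) * q - 1) = f (j - 1) + q - (if j = 0 then 1 else 0) := by
  by_cases h : j = 0
  · subst h
    have h1 : (0 - 1 : Fin (n + 1)) = Fin.last n := by apply Fin.ext; rw [Fin.coe_sub_one, if_pos rfl]; rfl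
    have := hF (Fin.last n) (q - 1)
    rw [h1, if_pos rfl]
    have h2 : (((0 : Fin (n + 1)) : ℕ) : ℤ) + ((n : ℤ) + 1) * q - 1
        = ((Fin.last n : Fin (n + 1)) : ℕ) + ((n : ℤ) + 1) * (q - 1) := by
      simp; ring
    rw [h2, this]; push_cast; ring
  · have h1 : ((j - 1 : Fin (n + 1)) : ℕ) = (j : ℕ) - 1 := by
      rw [Fin.coe_sub_one, if_neg h]
    have h3 : (j : ℕ) ≠ 0 := fun h' => h (Fin.ext h')
    have := hF (j - 1) q
    rw [if_neg h, sub_zero, ← this, h1]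
    congr 1
    omega

theorem stmt12 (K τ η : ℝ) (hK : 0 < K) (hτ : 0 < τ) (hη : 3 * τ / K < η)
    (n : ℕ) (a b : Fin (n + 1) → ℝ)
    (hab : ∀ i, a i < b i)
    (hchain : ∀ i : Fin n, b i.castSucc ≤ a i.succ)
    (ha0 : 0 ≤ a 0) (hb : b (Fin.last n) ≤ 1)
    (Λ : Finset (AddCircle (1 : ℝ)))
    (hΛX : (↑Λ : Set (AddCircle (1 : ℝ))) ⊆ ⋃ i, torus '' Set.Ioo (a i) (b i))
    (hcover : ∀ x ∈ ⋃ i, torus '' Set.Ioo (a i) (b i), ∃ l ∈ Λ, dist x l ≤ τ / K) :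
    ∃ m : ℕ, m ≤ Λ.card ∧ ∃ cc dd : Fin m → ℝ,
      (∀ i, cc i < dd i) ∧
      (∀ i j, i ≠ j →
        Disjoint (torus '' Set.Icc (cc i) (dd i)) (torus '' Set.Icc (cc j) (dd j))) ∧
      (((⋃ i, torus '' Set.Icc (a i) (b i)) ∪
        (⋃ j ∈ {j : Fin (n + 1) |
            (if j = 0 then a j + 1 - b (j - 1) else a j - b (j - 1)) < τ / K},
          torus '' (if j = 0 then Set.Icc (b (j - 1)) (a j + 1)
                    else Set.Icc (b (j - 1)) (a j))))
        = ⋃ i, torus '' Set.Icc (cc i) (dd i)) ∧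
      (∀ i, ∃ l ∈ Λ, l ∈ torus '' Set.Icc (cc i) (dd i)) ∧
      ((↑Λ : Set (AddCircle (1 : ℝ))) ⊆ ⋃ i, torus '' Set.Icc (cc i) (dd i)) ∧
      (∀ y ∈ ⋃ i, torus '' Set.Icc (cc i) (dd i), ∃ l ∈ Λ, dist y l ≤ η) ∧
      ∑ i, (dd i - cc i) ≤ (Λ.card : ℝ) * η := by
  obtain ⟨A, hA⟩ := ext_periodic n a
  obtain ⟨B, hB⟩ := ext_periodic n b
  have hBp := ext_prev n b B hB
  have hδ : 0 < τ / K := div_pos hτ hK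
  have hA0 : ∀ j : Fin (n + 1), A (j : ℕ) = a j := fun j => by simpa using hA j 0
  have hB0 : ∀ j : Fin (n + 1), B (j : ℕ) = b j := fun j => by simpa using hB j 0
  have hBp0 : ∀ j : Fin (n + 1), B ((j : ℕ) - 1) = b (j - 1) - (if j = 0 then 1 else 0) :=
    fun j => by simpa using hBp j 0
  have hper : ∀ (f : Fin (n + 1) → ℝ) (F : ℤ → ℝ),
      (∀ (j : Fin (n + 1)) (q : ℤ), F ((j : ℕ) + ((n : ℤ) + 1) * q) = f j + q) →
      ∀ i z : ℤ, F (i + ((n : ℤ) + 1) * z) = F i + z := by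
    intro f F hF i z
    obtain ⟨j, q, rfl⟩ := int_repr n i
    rw [add_assoc, ← mul_add, hF, hF]; push_cast; ring
  refine core (τ / K) η hδ (by rw [← mul_div_assoc]; exact hη) ((n : ℤ) + 1) (by omega) A B ?_ ?_
    (hper a A hA) (hper b B hB) Λ _ ?_ ?_ ?_ ?_ ?_
  · intro i
    obtain ⟨j, q, rfl⟩ := int_repr n i
    rw [hA, hB]; linarith [hab j]
  · intro i
    obtain ⟨j, q, rfl⟩ := int_repr n i
    rw [hA, hBp]
    by_cases h : j = 0
    · subst h
      have h1 : (0 - 1 : Fin (n + 1)) = Fin.last n := by apply Fin.ext; rw [Fin.coe_sub_one, if_pos rfl]; rfl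
      rw [h1, if_pos rfl]; linarith
    · obtain ⟨k, rfl⟩ := Fin.exists_succ_eq.2 h
      have h1 : k.succ - 1 = k.castSucc := by
        apply Fin.ext
        rw [Fin.coe_sub_one, if_neg h]; simp
      rw [if_neg h, h1]
      linarith [hchain k]
  · intro i x hx
    obtain ⟨j, q, rfl⟩ := int_repr n i
    rw [hA, hB] at hx
    left
    refine Set.mem_iUnion.2 ⟨j, x + ((-q : ℤ) : ℝ), ⟨?_, ?_⟩, torus_add_int _ _⟩
    · push_cast; linarith [hx.1]
    · push_cast; linarith [hx.2]
  · intro i hi x hx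
    obtain ⟨j, q, rfl⟩ := int_repr n i
    rw [hA, hBp] at hx hi
    right
    simp only [Set.mem_iUnion]
    by_cases h : j = 0
    · refine ⟨j, ?_, x + ((-q + 1 : ℤ) : ℝ), ?_, torus_add_int _ _⟩
      · simp only [Set.mem_setOf_eq, if_pos h] at hi ⊢; linarith
      · simp only [if_pos h] at hx ⊢
        push_cast
        exact ⟨by linarith [hx.1], by linarith [hx.2]⟩
    · refine ⟨j, ?_, x + ((-q : ℤ) : ℝ), ?_, torus_add_int _ _⟩
      · simp only [Set.mem_setOf_eq, if_neg h] at hi ⊢; linarith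
      · simp only [if_neg h] at hx ⊢
        push_cast
        exact ⟨by linarith [hx.1], by linarith [hx.2]⟩
  · rintro y (hy | hy)
    · obtain ⟨j, x, hx, rfl⟩ := Set.mem_iUnion.1 hy
      exact ⟨(j : ℕ), x, rfl, Or.inl (by rw [hA0, hB0]; exact hx)⟩
    · simp only [Set.mem_iUnion] at hy
      obtain ⟨j, hj, x, hx, rfl⟩ := hy
      by_cases h : j = 0
      · refine ⟨(j : ℕ), x + ((-1 : ℤ) : ℝ), torus_add_int _ _, Or.inr ?_⟩
        rw [hA0, hBp0]
        simp only [Set.mem_setOf_eq, if_pos h] at hj hx ⊢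
        push_cast
        exact ⟨by linarith, by linarith [hx.1], by linarith [hx.2]⟩
      · refine ⟨(j : ℕ), x, rfl, Or.inr ?_⟩
        rw [hA0, hBp0]
        simp only [Set.mem_setOf_eq, if_neg h] at hj hx ⊢
        exact ⟨by linarith, by linarith [hx.1], by linarith [hx.2]⟩
  · intro l hl
    obtain ⟨j, x, hx, rfl⟩ := Set.mem_iUnion.1 (hΛX hl)
    exact ⟨(j : ℕ), x, by rw [hA0, hB0]; exact hx, rfl⟩
  · intro i x hx
    obtain ⟨j, q, rfl⟩ := int_repr n i
    rw [hA, hB] at hx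
    refine hcover _ (Set.mem_iUnion.2 ⟨j, x + ((-q : ℤ) : ℝ), ⟨?_, ?_⟩, torus_add_int _ _⟩)
    · push_cast; linarith [hx.1]
    · push_cast; linarith [hx.2]
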